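/- Let f be an unbounded modulus function and θ = (k_r) a lacunary sequence with h_r = k_r − k_{r−1} and I_r = (k_{r−1}, k_r]. If f is not θ-compatible, then there exists a bounded real sequence (x_n) (hence lacunary uniformly integrable) which is lacunary f-statistically convergent to 0 but not lacunary f-strong Cesàro convergent to 0. Consequently, if every lacunary uniformly integrable, lacunary f-statistically convergent real sequence is lacunary f-strong Cesàro convergent (to the same limit), then f must be θ-compatible. -/

import Mathlib

open Filter Topology
open scoped Classical BigOperators

/-- A modulus function `f : ℝ → ℝ`, viewed on `[0, ∞)`: it vanishes exactly at `0`,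
is subadditive, increasing, and continuous from the right at `0`. -/
def IsModulusFunction (f : ℝ → ℝ) : Prop :=
  (∀ x : ℝ, 0 ≤ x → 0 ≤ f x) ∧
  (∀ x : ℝ, 0 ≤ x → (f x = 0 ↔ x = 0)) ∧
  (∀ x y : ℝ, 0 ≤ x → 0 ≤ y → f (x + y) ≤ f x + f y) ∧
  (∀ x y : ℝ, 0 ≤ x → x ≤ y → f x ≤ f y) ∧
  ContinuousWithinAt f (Set.Ici 0) 0

/-- An unbounded modulus function. -/
def IsUnboundedModulus (f : ℝ → ℝ) : Prop :=
  IsModulusFunction f ∧ ∀ M : ℝ, ∃ x : ℝ, 0 ≤ x ∧ M ≤ f x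

/-- `θ = (k_r)` is a lacunary sequence: increasing, `k_0 = 0`, and
`h_r = k_r - k_{r-1} → ∞`. -/
def IsLacunary (θ : ℕ → ℕ) : Prop :=
  θ 0 = 0 ∧ StrictMono θ ∧ Tendsto (fun r => θ r - θ (r - 1)) atTop atTop

/-- `h_r = k_r - k_{r-1}`. -/
def hgap (θ : ℕ → ℕ) (r : ℕ) : ℕ := θ r - θ (r - 1)

/-- `I_r = (k_{r-1}, k_r]` as a finite set of naturals. -/
def Ilac (θ : ℕ → ℕ) (r : ℕ) : Finset ℕ := Finset.Ioc (θ (r - 1)) (θ r)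

/-- The ratios `q_r = k_r / k_{r-1}`, valued in `ℝ≥0∞`. -/
noncomputable def qratio (θ : ℕ → ℕ) (r : ℕ) : ENNReal :=
  (θ r : ENNReal) / (θ (r - 1) : ENNReal)

/-- Lacunary strong Cesàro convergence of `(x_n)` to `L`:
`(1/h_r) Σ_{k ∈ I_r} ‖x_k - L‖ → 0`. -/
def LacStrongCesaro {X : Type*} [NormedAddCommGroup X] (θ : ℕ → ℕ) (x : ℕ → X) (L : X) : Prop :=
  Tendsto (fun r : ℕ => (∑ k ∈ Ilac θ r, ‖x k - L‖) / (hgap θ r : ℝ)) atTop (𝓝 0)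

/-- Lacunary `f`-strong Cesàro convergence of `(x_n)` to `L`:
`f (Σ_{k ∈ I_r} ‖x_k - L‖) / f (h_r) → 0`. -/
def LacFStrongCesaro (f : ℝ → ℝ) {X : Type*} [NormedAddCommGroup X] (θ : ℕ → ℕ)
    (x : ℕ → X) (L : X) : Prop :=
  Tendsto (fun r : ℕ => f (∑ k ∈ Ilac θ r, ‖x k - L‖) / f (hgap θ r : ℝ)) atTop (𝓝 0)

/-- Lacunary statistical convergence of `(x_n)` to `L`:
for every `ε > 0`, `(1/h_r) · #{k ∈ I_r : ‖x_k - L‖ > ε} → 0`. -/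
def LacStatConv {X : Type*} [NormedAddCommGroup X] (θ : ℕ → ℕ) (x : ℕ → X) (L : X) : Prop :=
  ∀ ε : ℝ, 0 < ε →
    Tendsto (fun r : ℕ =>
      ((((Ilac θ r).filter fun k => ε < ‖x k - L‖).card : ℝ)) / (hgap θ r : ℝ)) atTop (𝓝 0)

/-- Lacunary `f`-statistical convergence of `(x_n)` to `L`:
for every `ε > 0`, `f (#{k ∈ I_r : ‖x_k - L‖ > ε}) / f (h_r) → 0`. -/
def LacFStatConv (f : ℝ → ℝ) {X : Type*} [NormedAddCommGroup X] (θ : ℕ → ℕ)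
    (x : ℕ → X) (L : X) : Prop :=
  ∀ ε : ℝ, 0 < ε →
    Tendsto (fun r : ℕ =>
      f ((((Ilac θ r).filter fun k => ε < ‖x k - L‖).card : ℝ)) / f (hgap θ r : ℝ)) atTop (𝓝 0)

/-- `θ`-compatibility of `f`: `limsup_r f(h_r ε) / f(h_r) → 0` as `ε → 0⁺`. -/
def ThetaCompatible (f : ℝ → ℝ) (θ : ℕ → ℕ) : Prop :=
  Tendsto (fun ε : ℝ =>
      Filter.limsup (fun r : ℕ => f ((hgap θ r : ℝ) * ε) / f (hgap θ r : ℝ)) atTop)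
    (𝓝[>] (0 : ℝ)) (𝓝 0)

/-- Compatibility of `f`: `limsup_n f(n ε) / f(n) → 0` as `ε → 0⁺`. -/
def Compatible (f : ℝ → ℝ) : Prop :=
  Tendsto (fun ε : ℝ =>
      Filter.limsup (fun n : ℕ => f ((n : ℝ) * ε) / f (n : ℝ)) atTop)
    (𝓝[>] (0 : ℝ)) (𝓝 0)

/-- `f`-strong Cesàro convergence of `(x_n)` to `L`:
`f (Σ_{k=1}^n ‖x_k - L‖) / f (n) → 0`. -/
def FStrongCesaro (f : ℝ → ℝ) {X : Type*} [NormedAddCommGroup X] (x : ℕ → X) (L : X) : Prop :=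
  Tendsto (fun n : ℕ => f (∑ k ∈ Finset.Icc 1 n, ‖x k - L‖) / f (n : ℝ)) atTop (𝓝 0)

/-- Lacunary uniform integrability of `(x_n)`:
`sup_r (1/h_r) Σ_{k ∈ I_r, ‖x_k‖ ≥ M} ‖x_k‖ → 0` as `M → ∞`
(the supremum is taken in `ℝ≥0∞` to avoid junk values). -/
def LacUnifInt {X : Type*} [NormedAddCommGroup X] (θ : ℕ → ℕ) (x : ℕ → X) : Prop :=
  Tendsto (fun M : ℝ =>
      ⨆ r : ℕ, ENNReal.ofReal
        ((∑ k ∈ (Ilac θ r).filter fun k => M ≤ ‖x k‖, ‖x k‖) / (hgap θ r : ℝ)))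
    atTop (𝓝 0)

lemma aux_compat (f : ℝ → ℝ) (hf : IsModulusFunction f) (θ : ℕ → ℕ)
    (H : ∀ c : ℝ, 0 < c → ∃ n : ℕ, ∀ᶠ r in atTop,
      f ((hgap θ r : ℝ) * (1 / ((n : ℝ) + 1))) / f (hgap θ r : ℝ) ≤ c) :
    ThetaCompatible f θ := by
  obtain ⟨h0, hz, hsub, hmono, hcont⟩ := hf
  unfold ThetaCompatible
  rw [Metric.tendsto_nhds]
  intro c hc
  obtain ⟨n, hn⟩ := H (c / 2) (half_pos hc)
  have hpos : (0 : ℝ) < 1 / ((n : ℝ) + 1) := by positivity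
  filter_upwards [Ioo_mem_nhdsGT hpos] with ε hε
  have hnn : ∀ r : ℕ, 0 ≤ f ((hgap θ r : ℝ) * ε) / f (hgap θ r : ℝ) := fun r =>
    div_nonneg (h0 _ (mul_nonneg (Nat.cast_nonneg _) hε.1.le)) (h0 _ (Nat.cast_nonneg _))
  have hle : ∀ᶠ r in atTop, f ((hgap θ r : ℝ) * ε) / f (hgap θ r : ℝ) ≤ c / 2 := by
    filter_upwards [hn] with r hr
    refine le_trans ?_ hr
    exact div_le_div_of_nonneg_right
      (hmono _ _ (mul_nonneg (Nat.cast_nonneg _) hε.1.le)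
        (mul_le_mul_of_nonneg_left hε.2.le (Nat.cast_nonneg _))) (h0 _ (Nat.cast_nonneg _))
  have hb : IsBoundedUnder (· ≥ ·) atTop
      (fun r : ℕ => f ((hgap θ r : ℝ) * ε) / f (hgap θ r : ℝ)) :=
    isBoundedUnder_of ⟨0, hnn⟩
  have hb' : IsBoundedUnder (· ≤ ·) atTop
      (fun r : ℕ => f ((hgap θ r : ℝ) * ε) / f (hgap θ r : ℝ)) := ⟨c / 2, hle⟩
  have h1 := limsup_le_of_le hb.isCoboundedUnder_le hle
  have h2 := le_limsup_of_frequently_le (Eventually.of_forall hnn).frequently hb'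
  rw [Real.dist_eq, sub_zero, abs_of_nonneg h2]
  linarith

lemma aux_main (f : ℝ → ℝ) (hf : IsUnboundedModulus f) (θ : ℕ → ℕ) (hθ : IsLacunary θ)
    (hnc : ¬ ThetaCompatible f θ) :
      ∃ x : ℕ → ℝ, (∃ C : ℝ, ∀ n, |x n| ≤ C) ∧ LacUnifInt θ x ∧
        LacFStatConv f θ x 0 ∧ ¬ LacFStrongCesaro f θ x 0 := by
  have H := mt (aux_compat f hf.1 θ) hnc
  obtain ⟨⟨h0, hz, hsub, hmono, hcont⟩, -⟩ := hf
  obtain ⟨hθ0, hθm, -⟩ := hθ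
  push Not at H
  obtain ⟨c, hc, H⟩ := H
  obtain ⟨φ, hφ, hφc⟩ := extraction_forall_of_frequently H
  set u : ℕ → ℝ := fun n => 1 / ((n : ℝ) + 1) with hu
  have hu0 : ∀ n, 0 ≤ u n := fun n => by simp only [hu]; positivity
  have hu1 : ∀ n, u n ≤ 1 := fun n => by
    simp only [hu]
    rw [div_le_one (by positivity)]
    linarith [(Nat.cast_nonneg n : (0 : ℝ) ≤ n)]
  set a : ℕ → ℝ := Function.extend φ u 0 with ha
  have haφ : ∀ n, a (φ n) = u n := fun n => hφ.injective.extend_apply u 0 n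
  have hacase : ∀ r, (∃ n, φ n = r ∧ a r = u n) ∨ a r = 0 := by
    intro r
    by_cases h : ∃ n, φ n = r
    · obtain ⟨n, rfl⟩ := h
      exact Or.inl ⟨n, rfl, haφ n⟩
    · exact Or.inr (Function.extend_apply' _ _ _ h)
  have ha0 : ∀ r, 0 ≤ a r := by
    intro r
    rcases hacase r with ⟨n, _, h⟩ | h <;> rw [h]
    exact hu0 n
  have ha1 : ∀ r, a r ≤ 1 := by
    intro r
    rcases hacase r with ⟨n, _, h⟩ | h <;> rw [h]
    · exact hu1 n
    · exact zero_le_one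
  have hasmall : ∀ ε : ℝ, 0 < ε → ∀ᶠ r in atTop, a r ≤ ε := by
    intro ε hε
    obtain ⟨N, hN⟩ := exists_nat_one_div_lt hε
    filter_upwards [eventually_ge_atTop (φ N)] with r hr
    rcases hacase r with ⟨n, hn, h⟩ | h <;> rw [h]
    · rw [← hn] at hr
      have : N ≤ n := hφ.le_iff_le.mp hr
      refine le_trans ?_ hN.le
      exact one_div_le_one_div_of_le (by positivity) (by
        have : (N : ℝ) ≤ n := by exact_mod_cast this
        linarith)
    · exact hε.le
  set x : ℕ → ℝ := fun k => a (sInf {r | k ≤ θ r}) with hx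
  have hxI : ∀ r, ∀ k ∈ Ilac θ r, x k = a r := by
    intro r k hk
    simp only [Ilac, Finset.mem_Ioc] at hk
    simp only [hx]
    congr 1
    refine IsLeast.csInf_eq ⟨hk.2, ?_⟩
    intro s hs
    by_contra hlt
    have h1 : θ s ≤ θ (r - 1) := hθm.monotone (by omega)
    have h2 : k ≤ θ s := hs
    omega
  have hxn : ∀ k, ‖x k‖ ≤ 1 := fun k => by
    rw [Real.norm_eq_abs, abs_of_nonneg (ha0 _)]; exact ha1 _
  have hf0 : f 0 = 0 := (hz 0 le_rfl).2 rfl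
  refine ⟨x, ⟨1, hxn⟩, ?_, ?_, ?_⟩
  · unfold LacUnifInt
    refine tendsto_const_nhds.congr' ?_
    filter_upwards [eventually_gt_atTop (1 : ℝ)] with M hM
    symm
    rw [ENNReal.iSup_eq_zero]
    intro r
    rw [Finset.filter_false_of_mem (fun k _ => not_le.mpr (lt_of_le_of_lt (hxn k) hM))]
    simp
  · intro ε hε
    refine tendsto_const_nhds.congr' ?_
    filter_upwards [hasmall ε hε] with r hr
    rw [Finset.filter_false_of_mem]
    · simp [hf0]
    · intro k hk
      rw [sub_zero, hxI r k hk, Real.norm_eq_abs, abs_of_nonneg (ha0 _)]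
      exact not_lt.mpr hr
  · intro hT
    have h1 := (hT.comp hφ.tendsto_atTop).eventually (gt_mem_nhds hc)
    obtain ⟨n, hn⟩ := h1.exists
    have hs : ∑ k ∈ Ilac θ (φ n), ‖x k - 0‖ = (hgap θ (φ n) : ℝ) * (1 / ((n : ℝ) + 1)) := by
      rw [Finset.sum_congr rfl (g := fun _ => u n)]
      · simp [Ilac, hgap, hu]
      · intro k hk
        rw [sub_zero, hxI _ k hk, haφ, Real.norm_eq_abs, abs_of_nonneg (hu0 _)]
    simp only [Function.comp] at hn
    rw [hs] at hn
    exact lt_asymm hn (hφc n)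

/-- If `f` is not `θ`-compatible, there is a bounded (hence lacunary uniformly integrable)
real sequence which is lacunary `f`-statistically convergent to `0` but not lacunary
`f`-strong Cesàro convergent to `0`; consequently, if every lacunary uniformly integrable,
lacunary `f`-statistically convergent real sequence is lacunary `f`-strong Cesàro
convergent, then `f` must be `θ`-compatible. -/
theorem stmt9 (f : ℝ → ℝ) (hf : IsUnboundedModulus f) (θ : ℕ → ℕ) (hθ : IsLacunary θ) :
    (¬ ThetaCompatible f θ →
      ∃ x : ℕ → ℝ, (∃ C : ℝ, ∀ n, |x n| ≤ C) ∧ LacUnifInt θ x ∧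
        LacFStatConv f θ x 0 ∧ ¬ LacFStrongCesaro f θ x 0) ∧
    ((∀ (x : ℕ → ℝ) (L : ℝ), LacUnifInt θ x → LacFStatConv f θ x L →
        LacFStrongCesaro f θ x L) →
      ThetaCompatible f θ) := by
  refine ⟨aux_main f hf θ hθ, fun H => ?_⟩
  by_contra hnc
  obtain ⟨x, -, hUI, hS, hC⟩ := aux_main f hf θ hθ hnc
  exact hC (H x 0 hUI hS)
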